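/- (Finite-blocklength list version, converse.) For every choice of Alice's encoder (a conditional PMF P(M₁ = m₁, M₂ = m₂ | X = x, Y = y)), Bob's list ambiguity satisfies 𝒜_B^l ≥ max( 2^{ρ(H_{1/(1+ρ)}(X|Y) − log(|𝒨₁|·|𝒨₂|))}, 1 ), and the alternative Eve ambiguity satisfies Ã_E ≤ min( (min(|𝒨₁|,|𝒨₂|))^ρ · 𝒜_B^l, 2^{ρ H_{1/(1+ρ)}(X|Y)} ); since 𝒜_E ≤ Ã_E, the same upper bound holds for Eve's ambiguity 𝒜_E. -/

import Mathlib

open scoped BigOperators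

noncomputable section

/-- `G` is a guessing function for `X` given side information in `V`:
for every `v`, `G v` is a bijection from `X` onto `{1, …, |X|}`. -/
def IsGuess {X V : Type*} [Fintype X] (G : V → X → ℕ) : Prop :=
  ∀ v : V, Set.BijOn (G v) Set.univ (Set.Icc 1 (Fintype.card X))

/-- The conditional Rényi entropy `H_α(X|Y)` (base 2) of order `α = 1/(1+ρ)`. -/
def condRenyi {X Y : Type*} [Fintype X] [Fintype Y] (ρ : ℝ) (p : X → Y → ℝ) : ℝ :=
  ((1 / (1 + ρ)) / (1 - 1 / (1 + ρ))) *
    Real.logb 2 (∑ y : Y, (∑ x : X, p x y ^ (1 / (1 + ρ))) ^ (1 / (1 / (1 + ρ))))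

/-- Bob's guessing ambiguity `𝒜_B^g`: the least ρ-th moment of the number of guesses that
Bob, observing `(Y, M₁, M₂)`, needs to guess `X`. -/
def bobGuessAmb {𝒳 𝒴 M₁ M₂ : Type*} [Fintype 𝒳] [Fintype 𝒴] [Fintype M₁] [Fintype M₂]
    (ρ : ℝ) (p : 𝒳 → 𝒴 → ℝ) (e : 𝒳 → 𝒴 → M₁ × M₂ → ℝ) : ℝ :=
  sInf {r : ℝ | ∃ G : 𝒴 × M₁ × M₂ → 𝒳 → ℕ, IsGuess G ∧
    r = ∑ x : 𝒳, ∑ y : 𝒴, ∑ m : M₁ × M₂, p x y * e x y m * (G (y, m) x : ℝ) ^ ρ}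

/-- Bob's list ambiguity `𝒜_B^l`: the ρ-th moment of the size of the list of realizations
of `X` with positive posterior probability given `(Y, M₁, M₂)`. -/
def bobListAmb {𝒳 𝒴 M₁ M₂ : Type*} [Fintype 𝒳] [Fintype 𝒴] [Fintype M₁] [Fintype M₂]
    (ρ : ℝ) (p : 𝒳 → 𝒴 → ℝ) (e : 𝒳 → 𝒴 → M₁ × M₂ → ℝ) : ℝ :=
  ∑ x : 𝒳, ∑ y : 𝒴, ∑ m : M₁ × M₂, p x y * e x y m *
    (((Finset.univ.filter fun x' : 𝒳 => 0 < p x' y * e x' y m).card : ℝ)) ^ ρ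

/-- Eve's ambiguity `𝒜_E`: the least ρ-th moment of the number of guesses, where for every
realization the more informative of the two hints is used. -/
def eveAmb {𝒳 𝒴 M₁ M₂ : Type*} [Fintype 𝒳] [Fintype 𝒴] [Fintype M₁] [Fintype M₂]
    (ρ : ℝ) (p : 𝒳 → 𝒴 → ℝ) (e : 𝒳 → 𝒴 → M₁ × M₂ → ℝ) : ℝ :=
  sInf {r : ℝ | ∃ G₁ : 𝒴 × M₁ → 𝒳 → ℕ, ∃ G₂ : 𝒴 × M₂ → 𝒳 → ℕ, IsGuess G₁ ∧ IsGuess G₂ ∧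
    r = ∑ x : 𝒳, ∑ y : 𝒴, ∑ m₁ : M₁, ∑ m₂ : M₂, p x y * e x y (m₁, m₂) *
      ((min (G₁ (y, m₁) x) (G₂ (y, m₂) x) : ℕ) : ℝ) ^ ρ}

/-- The alternative (less conservative) Eve ambiguity `Ã_E`. -/
def eveAmbAlt {𝒳 𝒴 M₁ M₂ : Type*} [Fintype 𝒳] [Fintype 𝒴] [Fintype M₁] [Fintype M₂]
    (ρ : ℝ) (p : 𝒳 → 𝒴 → ℝ) (e : 𝒳 → 𝒴 → M₁ × M₂ → ℝ) : ℝ :=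
  min
    (sInf {r : ℝ | ∃ G₁ : 𝒴 × M₁ → 𝒳 → ℕ, IsGuess G₁ ∧
      r = ∑ x : 𝒳, ∑ y : 𝒴, ∑ m₁ : M₁, ∑ m₂ : M₂, p x y * e x y (m₁, m₂) *
        (G₁ (y, m₁) x : ℝ) ^ ρ})
    (sInf {r : ℝ | ∃ G₂ : 𝒴 × M₂ → 𝒳 → ℕ, IsGuess G₂ ∧
      r = ∑ x : 𝒳, ∑ y : 𝒴, ∑ m₁ : M₁, ∑ m₂ : M₂, p x y * e x y (m₁, m₂) *
        (G₂ (y, m₂) x : ℝ) ^ ρ})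

theorem exists_isGuess_le_card {V X T : Type*} [Fintype X] [LinearOrder T] (t : V → X → T) :
    ∃ G : V → X → ℕ, IsGuess G ∧
      ∀ v x, G v x ≤ (Finset.univ.filter fun x' => t v x' ≤ t v x).card := by
  classical
  let e := Fintype.equivFin X
  let σ : V → Equiv.Perm (Fin (Fintype.card X)) := fun v => Tuple.sort (t v ∘ e.symm)
  have hσ : ∀ v, Monotone ((t v ∘ e.symm) ∘ σ v) := fun v => Tuple.monotone_sort _
  refine ⟨fun v x => ((σ v).symm (e x) : ℕ) + 1, fun v => ⟨fun x _ => ?_, fun x _ x' _ h => ?_,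
    fun k hk => ?_⟩, fun v x => ?_⟩
  · exact ⟨Nat.le_add_left _ _, ((σ v).symm (e x)).isLt⟩
  · have h' : (((σ v).symm (e x) : Fin _) : ℕ) = (σ v).symm (e x') := Nat.succ_injective h
    exact e.injective ((σ v).symm.injective (Fin.ext h'))
  · obtain ⟨h1, h2⟩ := hk
    refine ⟨e.symm (σ v ⟨k - 1, by omega⟩), Set.mem_univ _, ?_⟩
    simp only [Equiv.apply_symm_apply, Equiv.symm_apply_apply]
    omega
  · set i := (σ v).symm (e x) with hi
    have hx : e.symm (σ v i) = x := by simp [hi]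
    have hcard : (Finset.Iic i).card = (i : ℕ) + 1 := by simp
    change (i : ℕ) + 1 ≤ _
    rw [← hcard]
    refine Finset.card_le_card_of_injOn (fun j => e.symm (σ v j)) (fun j hj => ?_)
      fun j _ j' _ h => (σ v).injective (e.symm.injective h)
    have hji : j ≤ i := by simpa using hj
    have h := hσ v hji
    simp only [Function.comp_apply, hx] at h
    simpa using h

theorem exists_isGuess_le_card_mul {V I X : Type*} [Fintype I] [Fintype X]
    (L : V → I → Finset X) :
    ∃ G : V → X → ℕ, IsGuess G ∧
      ∀ v i x, x ∈ L v i → G v x ≤ Fintype.card I * (L v i).card := by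
  classical
  obtain ⟨G, hG, hle⟩ := exists_isGuess_le_card fun v x =>
    (Finset.univ.filter fun i => x ∈ L v i).inf fun i => ((L v i).card : WithTop ℕ)
  refine ⟨G, hG, fun v i x hx => (hle v x).trans ?_⟩
  have hti : ((Finset.univ.filter fun i => x ∈ L v i).inf fun i => ((L v i).card : WithTop ℕ)) ≤
      ((L v i).card : WithTop ℕ) := Finset.inf_le (by simpa using hx)
  calc _ ≤ ((Finset.univ.filter fun j => (L v j).card ≤ (L v i).card).biUnion (L v)).card := by
        refine Finset.card_le_card fun x' hx' => ?_
        have h := (Finset.mem_filter.1 hx').2.trans hti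
        rw [Finset.inf_le_iff (WithTop.coe_lt_top _)] at h
        obtain ⟨j, hj, hjl⟩ := h
        exact Finset.mem_biUnion.2 ⟨j, by simpa using hjl, (Finset.mem_filter.1 hj).2⟩
    _ ≤ (Finset.univ.filter fun j => (L v j).card ≤ (L v i).card).card * (L v i).card :=
        Finset.card_biUnion_le_card_mul _ _ _ fun j hj => (Finset.mem_filter.1 hj).2
    _ ≤ Fintype.card I * (L v i).card :=
        Nat.mul_le_mul_right _ (Finset.card_le_univ _)

theorem exists_isGuess {V X : Type*} [Fintype X] : ∃ G : V → X → ℕ, IsGuess G := by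
  obtain ⟨G, hG, -⟩ := exists_isGuess_le_card fun (_ : V) (_ : X) => (0 : ℕ)
  exact ⟨G, hG⟩

theorem rpow_sum_rpow_le_card_rpow_mul_sum {ι : Type*} (s : Finset ι) {ρ : ℝ} (hρ : 0 < ρ)
    {a : ι → ℝ} (ha : ∀ i, 0 ≤ a i) :
    (∑ i ∈ s, a i ^ (1 / (1 + ρ))) ^ (1 + ρ) ≤ (s.card : ℝ) ^ ρ * ∑ i ∈ s, a i := by
  have h := Real.rpow_sum_le_const_mul_sum_rpow s (fun i => a i ^ (1 / (1 + ρ)))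
    (p := 1 + ρ) (by linarith)
  have habs : ∀ i, |a i ^ (1 / (1 + ρ))| = a i ^ (1 / (1 + ρ)) := fun i =>
    abs_of_nonneg (Real.rpow_nonneg (ha i) _)
  have hpow : ∀ i, (a i ^ (1 / (1 + ρ))) ^ (1 + ρ) = a i := fun i => by
    rw [← Real.rpow_mul (ha i), one_div_mul_cancel (by positivity), Real.rpow_one]
  simpa only [habs, hpow, add_sub_cancel_left] using h

theorem rpow_sum_le_card_rpow_mul_sum_list {X M : Type*} [Fintype X] [Fintype M] {ρ : ℝ}
    (hρ : 0 < ρ) {q : X → ℝ} (hq : ∀ x, 0 ≤ q x) {e : X → M → ℝ} (he0 : ∀ x m, 0 ≤ e x m)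
    (he1 : ∀ x, ∑ m, e x m = 1) :
    (∑ x, q x ^ (1 / (1 + ρ))) ^ (1 + ρ) ≤ (Fintype.card M : ℝ) ^ ρ *
      ∑ x, ∑ m, q x * e x m *
        ((Finset.univ.filter fun x' => 0 < q x' * e x' m).card : ℝ) ^ ρ := by
  have hα : 0 < 1 / (1 + ρ) := by positivity
  have hα1 : 1 / (1 + ρ) ≤ 1 := by rw [div_le_one (by positivity)]; linarith
  have hqe : ∀ x m, 0 ≤ q x * e x m := fun x m => mul_nonneg (hq x) (he0 x m)
  set L : M → Finset X := fun m => Finset.univ.filter fun x' => 0 < q x' * e x' m with hL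
  have hsupp : ∀ m x, x ∉ L m → q x * e x m = 0 := fun m x hx =>
    le_antisymm (by simpa [hL] using hx) (hqe x m)
  have hsplit : ∀ x, q x ^ (1 / (1 + ρ)) ≤ ∑ m, (q x * e x m) ^ (1 / (1 + ρ)) := fun x => by
    have hle : ∀ m, e x m ≤ e x m ^ (1 / (1 + ρ)) := fun m => by
      refine Real.self_le_rpow_of_le_one (he0 x m) ?_ hα1
      rw [← he1 x]
      exact Finset.single_le_sum (fun m _ => he0 x m) (Finset.mem_univ m)
    calc q x ^ (1 / (1 + ρ)) = q x ^ (1 / (1 + ρ)) * ∑ m, e x m := by rw [he1, mul_one]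
      _ ≤ q x ^ (1 / (1 + ρ)) * ∑ m, e x m ^ (1 / (1 + ρ)) :=
        mul_le_mul_of_nonneg_left (Finset.sum_le_sum fun m _ => hle m)
          (Real.rpow_nonneg (hq x) _)
      _ = _ := by simp only [Finset.mul_sum, Real.mul_rpow (hq x) (he0 x _)]
  let b : M → ℝ := fun m => (∑ x ∈ L m, (q x * e x m) ^ (1 / (1 + ρ))) ^ (1 + ρ)
  have hb0 : ∀ m, 0 ≤ ∑ x ∈ L m, (q x * e x m) ^ (1 / (1 + ρ)) := fun m =>
    Finset.sum_nonneg fun x _ => Real.rpow_nonneg (hqe x m) _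
  have hb : ∀ m, b m ^ (1 / (1 + ρ)) = ∑ x, (q x * e x m) ^ (1 / (1 + ρ)) := fun m => by
    rw [← Real.rpow_mul (hb0 m), mul_one_div_cancel (by positivity), Real.rpow_one]
    refine Finset.sum_subset (Finset.subset_univ _) fun x _ hx => ?_
    rw [hsupp m x hx, Real.zero_rpow hα.ne']
  calc (∑ x, q x ^ (1 / (1 + ρ))) ^ (1 + ρ)
      ≤ (∑ m, b m ^ (1 / (1 + ρ))) ^ (1 + ρ) := by
        refine Real.rpow_le_rpow (Finset.sum_nonneg fun x _ => Real.rpow_nonneg (hq x) _) ?_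
          (by positivity)
        simp only [hb]
        rw [Finset.sum_comm]
        exact Finset.sum_le_sum fun x _ => hsplit x
    _ ≤ (Fintype.card M : ℝ) ^ ρ * ∑ m, b m :=
        rpow_sum_rpow_le_card_rpow_mul_sum _ hρ fun m => Real.rpow_nonneg (hb0 m) _
    _ ≤ _ := by
        rw [Finset.sum_comm (s := (Finset.univ : Finset X))]
        refine mul_le_mul_of_nonneg_left (Finset.sum_le_sum fun m _ => ?_) (by positivity)
        refine (rpow_sum_rpow_le_card_rpow_mul_sum (L m) hρ fun x => hqe x m).trans ?_
        rw [mul_comm, Finset.sum_mul]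
        exact Finset.sum_le_sum_of_subset_of_nonneg (Finset.subset_univ _)
          fun x _ _ => mul_nonneg (hqe x m) (by positivity)

theorem two_rpow_mul_condRenyi {X Y : Type*} [Fintype X] [Fintype Y] {ρ : ℝ} (hρ : 0 < ρ)
    {p : X → Y → ℝ} (hp0 : ∀ x y, 0 ≤ p x y) (hp1 : ∑ x, ∑ y, p x y = 1) :
    (2 : ℝ) ^ (ρ * condRenyi ρ p) = ∑ y, (∑ x, p x y ^ (1 / (1 + ρ))) ^ (1 + ρ) := by
  have hsum : ∀ y, 0 ≤ ∑ x, p x y ^ (1 / (1 + ρ)) := fun y =>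
    Finset.sum_nonneg fun x _ => Real.rpow_nonneg (hp0 x y) _
  have hpos : 0 < ∑ y, (∑ x, p x y ^ (1 / (1 + ρ))) ^ (1 + ρ) := by
    obtain ⟨x, -, hx⟩ := Finset.exists_ne_zero_of_sum_ne_zero (hp1.trans_ne one_ne_zero)
    obtain ⟨y, -, hxy⟩ := Finset.exists_ne_zero_of_sum_ne_zero hx
    refine Finset.sum_pos' (fun y _ => Real.rpow_nonneg (hsum y) _) ⟨y, Finset.mem_univ y, ?_⟩
    refine Real.rpow_pos_of_pos (Finset.sum_pos' (fun x _ => Real.rpow_nonneg (hp0 x y) _)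
      ⟨x, Finset.mem_univ x, Real.rpow_pos_of_pos ((hp0 x y).lt_of_ne' hxy) _⟩) _
  have hcoef : ρ * ((1 / (1 + ρ)) / (1 - 1 / (1 + ρ))) = 1 := by
    have h1 : 1 + ρ ≠ 0 := by positivity
    have h2 : 1 - 1 / (1 + ρ) = ρ / (1 + ρ) := by field_simp; ring
    rw [h2]
    field_simp
  rw [condRenyi, ← mul_assoc, hcoef, one_mul, one_div_one_div,
    Real.rpow_logb two_pos (by norm_num) hpos]

theorem sum_mul_card_rpow_le {X : Type*} [Fintype X] {ρ : ℝ} (hρ : 0 < ρ) {q : X → ℝ}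
    (hq : ∀ x, 0 ≤ q x) :
    ∑ x, q x * ((Finset.univ.filter fun x' => q x ≤ q x').card : ℝ) ^ ρ ≤
      (∑ x, q x ^ (1 / (1 + ρ))) ^ (1 + ρ) := by
  have hα : 0 < 1 / (1 + ρ) := by positivity
  set T := ∑ x, q x ^ (1 / (1 + ρ)) with hT
  have hqα : ∀ x, 0 ≤ q x ^ (1 / (1 + ρ)) := fun x => Real.rpow_nonneg (hq x) _
  have hT0 : 0 ≤ T := Finset.sum_nonneg fun x _ => hqα x
  rw [Real.rpow_add_of_nonneg hT0 zero_le_one hρ.le, Real.rpow_one]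
  conv_rhs => rw [hT, Finset.sum_mul, ← hT]
  refine Finset.sum_le_sum fun x _ => ?_
  have hcard : ((Finset.univ.filter fun x' => q x ≤ q x').card : ℝ) * q x ^ (1 / (1 + ρ)) ≤ T := by
    rw [← nsmul_eq_mul, ← Finset.sum_const]
    refine (Finset.sum_le_sum fun x' hx' => Real.rpow_le_rpow (hq x)
      (Finset.mem_filter.1 hx').2 hα.le).trans ?_
    exact Finset.sum_le_sum_of_subset_of_nonneg (Finset.subset_univ _) fun x _ _ => hqα x
  have hsplit : q x = q x ^ (1 / (1 + ρ)) * (q x ^ (1 / (1 + ρ))) ^ ρ := by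
    rw [← Real.rpow_mul (hq x), ← Real.rpow_add_of_nonneg (hq x) hα.le (by positivity)]
    have : 1 / (1 + ρ) + 1 / (1 + ρ) * ρ = 1 := by field_simp
    rw [this, Real.rpow_one]
  calc q x * ((Finset.univ.filter fun x' => q x ≤ q x').card : ℝ) ^ ρ
      = q x ^ (1 / (1 + ρ)) *
        (((Finset.univ.filter fun x' => q x ≤ q x').card : ℝ) * q x ^ (1 / (1 + ρ))) ^ ρ := by
        rw [Real.mul_rpow (Nat.cast_nonneg _) (hqα x)]
        linear_combination
          ((Finset.univ.filter fun x' => q x ≤ q x').card : ℝ) ^ ρ * hsplit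
    _ ≤ q x ^ (1 / (1 + ρ)) * T ^ ρ :=
        mul_le_mul_of_nonneg_left (Real.rpow_le_rpow
          (mul_nonneg (Nat.cast_nonneg _) (hqα x)) hcard hρ.le) (hqα x)

section Ambiguity

variable {𝒳 𝒴 M₁ M₂ : Type*} [Fintype 𝒳] [Fintype 𝒴] [Fintype M₁] [Fintype M₂]
  {ρ : ℝ} {p : 𝒳 → 𝒴 → ℝ} {e : 𝒳 → 𝒴 → M₁ × M₂ → ℝ}

theorem moment_nonneg (hp0 : ∀ x y, 0 ≤ p x y) (he0 : ∀ x y m, 0 ≤ e x y m)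
    (g : 𝒳 → 𝒴 → M₁ → M₂ → ℕ) :
    0 ≤ ∑ x, ∑ y, ∑ m₁, ∑ m₂, p x y * e x y (m₁, m₂) * (g x y m₁ m₂ : ℝ) ^ ρ :=
  Finset.sum_nonneg fun x _ => Finset.sum_nonneg fun y _ => Finset.sum_nonneg fun _ _ =>
    Finset.sum_nonneg fun _ _ => mul_nonneg (mul_nonneg (hp0 x y) (he0 x y _))
      (Real.rpow_nonneg (Nat.cast_nonneg _) _)

theorem moment_mono (hρ : 0 < ρ) (hp0 : ∀ x y, 0 ≤ p x y) (he0 : ∀ x y m, 0 ≤ e x y m)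
    {g g' : 𝒳 → 𝒴 → M₁ → M₂ → ℕ} (h : ∀ x y m₁ m₂, g x y m₁ m₂ ≤ g' x y m₁ m₂) :
    ∑ x, ∑ y, ∑ m₁, ∑ m₂, p x y * e x y (m₁, m₂) * (g x y m₁ m₂ : ℝ) ^ ρ ≤
      ∑ x, ∑ y, ∑ m₁, ∑ m₂, p x y * e x y (m₁, m₂) * (g' x y m₁ m₂ : ℝ) ^ ρ :=
  Finset.sum_le_sum fun x _ => Finset.sum_le_sum fun y _ => Finset.sum_le_sum fun m₁ _ =>
    Finset.sum_le_sum fun m₂ _ => mul_le_mul_of_nonneg_left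
      (Real.rpow_le_rpow (Nat.cast_nonneg _) (Nat.cast_le.2 (h x y m₁ m₂)) hρ.le)
      (mul_nonneg (hp0 x y) (he0 x y _))

theorem moment_le_of_le_mul_list (hρ : 0 < ρ) (hp0 : ∀ x y, 0 ≤ p x y)
    (he0 : ∀ x y m, 0 ≤ e x y m) (g : 𝒳 → 𝒴 → M₁ → M₂ → ℕ) (K : ℕ)
    (h : ∀ x y m₁ m₂, 0 < p x y * e x y (m₁, m₂) → g x y m₁ m₂ ≤
      K * (Finset.univ.filter fun x' => 0 < p x' y * e x' y (m₁, m₂)).card) :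
    ∑ x, ∑ y, ∑ m₁, ∑ m₂, p x y * e x y (m₁, m₂) * (g x y m₁ m₂ : ℝ) ^ ρ ≤
      (K : ℝ) ^ ρ * bobListAmb ρ p e := by
  simp only [bobListAmb, Finset.mul_sum, Fintype.sum_prod_type]
  refine Finset.sum_le_sum fun x _ => Finset.sum_le_sum fun y _ => Finset.sum_le_sum fun m₁ _ =>
    Finset.sum_le_sum fun m₂ _ => ?_
  rcases (mul_nonneg (hp0 x y) (he0 x y (m₁, m₂))).eq_or_lt with h0 | h0
  · simp [← h0]
  · rw [mul_left_comm, ← Real.mul_rpow (Nat.cast_nonneg _) (Nat.cast_nonneg _)]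
    refine mul_le_mul_of_nonneg_left (Real.rpow_le_rpow (Nat.cast_nonneg _) ?_ hρ.le) h0.le
    exact_mod_cast h x y m₁ m₂ h0

theorem eveAmbAlt_le_left (hp0 : ∀ x y, 0 ≤ p x y) (he0 : ∀ x y m, 0 ≤ e x y m)
    {G : 𝒴 × M₁ → 𝒳 → ℕ} (hG : IsGuess G) :
    eveAmbAlt ρ p e ≤ ∑ x, ∑ y, ∑ m₁, ∑ m₂, p x y * e x y (m₁, m₂) * (G (y, m₁) x : ℝ) ^ ρ := by
  refine (min_le_left _ _).trans (csInf_le ⟨0, ?_⟩ ⟨G, hG, rfl⟩)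
  rintro r ⟨G, -, rfl⟩
  exact moment_nonneg hp0 he0 fun x y m₁ _ => G (y, m₁) x

theorem eveAmbAlt_le_right (hp0 : ∀ x y, 0 ≤ p x y) (he0 : ∀ x y m, 0 ≤ e x y m)
    {G : 𝒴 × M₂ → 𝒳 → ℕ} (hG : IsGuess G) :
    eveAmbAlt ρ p e ≤ ∑ x, ∑ y, ∑ m₁, ∑ m₂, p x y * e x y (m₁, m₂) * (G (y, m₂) x : ℝ) ^ ρ := by
  refine (min_le_right _ _).trans (csInf_le ⟨0, ?_⟩ ⟨G, hG, rfl⟩)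
  rintro r ⟨G, -, rfl⟩
  exact moment_nonneg hp0 he0 fun x y _ m₂ => G (y, m₂) x

theorem eveAmb_le_eveAmbAlt (hρ : 0 < ρ) (hp0 : ∀ x y, 0 ≤ p x y)
    (he0 : ∀ x y m, 0 ≤ e x y m) : eveAmb ρ p e ≤ eveAmbAlt ρ p e := by
  obtain ⟨F₁, hF₁⟩ := exists_isGuess (V := 𝒴 × M₁) (X := 𝒳)
  obtain ⟨F₂, hF₂⟩ := exists_isGuess (V := 𝒴 × M₂) (X := 𝒳)
  have key : ∀ (G₁ : 𝒴 × M₁ → 𝒳 → ℕ) (G₂ : 𝒴 × M₂ → 𝒳 → ℕ), IsGuess G₁ → IsGuess G₂ →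
      eveAmb ρ p e ≤ ∑ x, ∑ y, ∑ m₁, ∑ m₂, p x y * e x y (m₁, m₂) *
        ((min (G₁ (y, m₁) x) (G₂ (y, m₂) x) : ℕ) : ℝ) ^ ρ := fun G₁ G₂ h₁ h₂ => by
    refine csInf_le ⟨0, ?_⟩ ⟨G₁, G₂, h₁, h₂, rfl⟩
    rintro r ⟨G₁, G₂, -, -, rfl⟩
    exact moment_nonneg hp0 he0 fun x y m₁ m₂ => min (G₁ (y, m₁) x) (G₂ (y, m₂) x)
  refine le_min (le_csInf ⟨_, F₁, hF₁, rfl⟩ ?_) (le_csInf ⟨_, F₂, hF₂, rfl⟩ ?_)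
  · rintro r ⟨G, hG, rfl⟩
    exact (key G F₂ hG hF₂).trans (moment_mono hρ hp0 he0
      (g := fun x y m₁ m₂ => min (G (y, m₁) x) (F₂ (y, m₂) x))
      (g' := fun x y m₁ _ => G (y, m₁) x) fun _ _ _ _ => min_le_left _ _)
  · rintro r ⟨G, hG, rfl⟩
    exact (key F₁ G hF₁ hG).trans (moment_mono hρ hp0 he0
      (g := fun x y m₁ m₂ => min (F₁ (y, m₁) x) (G (y, m₂) x))
      (g' := fun x y _ m₂ => G (y, m₂) x) fun _ _ _ _ => min_le_right _ _)

theorem eveAmbAlt_le_card_rpow_mul_bobListAmb (hρ : 0 < ρ) (hp0 : ∀ x y, 0 ≤ p x y)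
    (he0 : ∀ x y m, 0 ≤ e x y m) :
    eveAmbAlt ρ p e ≤
      ((min (Fintype.card M₁) (Fintype.card M₂) : ℕ) : ℝ) ^ ρ * bobListAmb ρ p e := by
  rcases min_choice (Fintype.card M₁) (Fintype.card M₂) with h | h
  · obtain ⟨G, hG, hle⟩ := exists_isGuess_le_card_mul fun (v : 𝒴 × M₂) (m₁ : M₁) =>
      Finset.univ.filter fun x : 𝒳 => 0 < p x v.1 * e x v.1 (m₁, v.2)
    rw [h]
    exact (eveAmbAlt_le_right hp0 he0 hG).trans <|
      moment_le_of_le_mul_list hρ hp0 he0 (fun x y _ m₂ => G (y, m₂) x) _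
        fun x y m₁ m₂ hx => hle (y, m₂) m₁ x (by simpa using hx)
  · obtain ⟨G, hG, hle⟩ := exists_isGuess_le_card_mul fun (v : 𝒴 × M₁) (m₂ : M₂) =>
      Finset.univ.filter fun x : 𝒳 => 0 < p x v.1 * e x v.1 (v.2, m₂)
    rw [h]
    exact (eveAmbAlt_le_left hp0 he0 hG).trans <|
      moment_le_of_le_mul_list hρ hp0 he0 (fun x y m₁ _ => G (y, m₁) x) _
        fun x y m₁ m₂ hx => hle (y, m₁) m₂ x (by simpa using hx)

theorem eveAmbAlt_le_two_rpow_mul_condRenyi (hρ : 0 < ρ) (hp0 : ∀ x y, 0 ≤ p x y)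
    (hp1 : ∑ x, ∑ y, p x y = 1) (he0 : ∀ x y m, 0 ≤ e x y m)
    (he1 : ∀ x y, ∑ m, e x y m = 1) :
    eveAmbAlt ρ p e ≤ (2 : ℝ) ^ (ρ * condRenyi ρ p) := by
  obtain ⟨G, hG, hle⟩ := exists_isGuess_le_card fun (y : 𝒴) (x : 𝒳) => - p x y
  have hG' : IsGuess fun (v : 𝒴 × M₁) => G v.1 := fun v => hG v.1
  refine (eveAmbAlt_le_left hp0 he0 hG').trans ?_
  have hsum : ∀ x y, ∑ m₁, ∑ m₂, p x y * e x y (m₁, m₂) * (G y x : ℝ) ^ ρ =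
      p x y * (G y x : ℝ) ^ ρ := fun x y => by
    have h := he1 x y
    rw [Fintype.sum_prod_type] at h
    simp only [← Finset.sum_mul, ← Finset.mul_sum, h, mul_one]
  simp only [hsum]
  rw [two_rpow_mul_condRenyi hρ hp0 hp1, Finset.sum_comm]
  refine Finset.sum_le_sum fun y _ => le_trans (Finset.sum_le_sum fun x _ => ?_)
    (sum_mul_card_rpow_le hρ fun x => hp0 x y)
  refine mul_le_mul_of_nonneg_left
    (Real.rpow_le_rpow (Nat.cast_nonneg _) (Nat.cast_le.2 ?_) hρ.le) (hp0 x y)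
  simpa only [neg_le_neg_iff] using hle y x

theorem one_le_bobListAmb (hρ : 0 < ρ) (hp0 : ∀ x y, 0 ≤ p x y)
    (hp1 : ∑ x, ∑ y, p x y = 1) (he0 : ∀ x y m, 0 ≤ e x y m)
    (he1 : ∀ x y, ∑ m, e x y m = 1) : 1 ≤ bobListAmb ρ p e := by
  have hsum : ∑ x, ∑ y, ∑ m, p x y * e x y m = 1 := by
    simp only [← Finset.mul_sum, he1, mul_one, hp1]
  rw [bobListAmb, ← hsum]
  refine Finset.sum_le_sum fun x _ => Finset.sum_le_sum fun y _ => Finset.sum_le_sum fun m _ => ?_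
  rcases (mul_nonneg (hp0 x y) (he0 x y m)).eq_or_lt with h0 | h0
  · simp [← h0]
  · refine le_mul_of_one_le_right h0.le (Real.one_le_rpow ?_ hρ.le)
    exact_mod_cast Finset.card_pos.2 ⟨x, by simpa using h0⟩

theorem two_rpow_le_bobListAmb (hρ : 0 < ρ) (hp0 : ∀ x y, 0 ≤ p x y)
    (hp1 : ∑ x, ∑ y, p x y = 1) (he0 : ∀ x y m, 0 ≤ e x y m)
    (he1 : ∀ x y, ∑ m, e x y m = 1) :
    (2 : ℝ) ^ (ρ * (condRenyi ρ p -
      Real.logb 2 ((Fintype.card M₁ * Fintype.card M₂ : ℕ) : ℝ))) ≤ bobListAmb ρ p e := by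
  have hK : 0 < Fintype.card M₁ * Fintype.card M₂ := by
    obtain ⟨x, -, hx⟩ := Finset.exists_ne_zero_of_sum_ne_zero (hp1.trans_ne one_ne_zero)
    obtain ⟨y, -, -⟩ := Finset.exists_ne_zero_of_sum_ne_zero hx
    obtain ⟨m, -, -⟩ := Finset.exists_ne_zero_of_sum_ne_zero ((he1 x y).trans_ne one_ne_zero)
    rw [← Fintype.card_prod]
    exact Fintype.card_pos_iff.2 ⟨m⟩
  have hK' : (0 : ℝ) < ((Fintype.card M₁ * Fintype.card M₂ : ℕ) : ℝ) := Nat.cast_pos.2 hK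
  rw [mul_sub, Real.rpow_sub two_pos, mul_comm ρ (Real.logb _ _),
    Real.rpow_mul zero_le_two (Real.logb _ _),
    Real.rpow_logb two_pos (by norm_num) hK', div_le_iff₀ (Real.rpow_pos_of_pos hK' _),
    two_rpow_mul_condRenyi hρ hp0 hp1, mul_comm, bobListAmb,
    Finset.sum_comm (s := (Finset.univ : Finset 𝒳)) (t := (Finset.univ : Finset 𝒴)),
    Finset.mul_sum, ← Fintype.card_prod]
  exact Finset.sum_le_sum fun y _ => rpow_sum_le_card_rpow_mul_sum_list hρ (fun x => hp0 x y)
    (fun x m => he0 x y m) fun x => he1 x y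

end Ambiguity

/-- Theorem 6 (finite-blocklength list version), converse part. -/
theorem distributed_storage_list_converse
    {𝒳 𝒴 M₁ M₂ : Type*} [Fintype 𝒳] [Fintype 𝒴] [Fintype M₁] [Fintype M₂]
    (ρ : ℝ) (hρ : 0 < ρ)
    (p : 𝒳 → 𝒴 → ℝ) (hp0 : ∀ x y, 0 ≤ p x y) (hp1 : ∑ x : 𝒳, ∑ y : 𝒴, p x y = 1)
    (e : 𝒳 → 𝒴 → M₁ × M₂ → ℝ)
    (he0 : ∀ x y m, 0 ≤ e x y m) (he1 : ∀ x y, ∑ m : M₁ × M₂, e x y m = 1) :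
    bobListAmb ρ p e ≥
      max ((2 : ℝ) ^ (ρ * (condRenyi ρ p -
        Real.logb 2 ((Fintype.card M₁ * Fintype.card M₂ : ℕ) : ℝ)))) 1 ∧
    eveAmbAlt ρ p e ≤
      min (((min (Fintype.card M₁) (Fintype.card M₂) : ℕ) : ℝ) ^ ρ * bobListAmb ρ p e)
        ((2 : ℝ) ^ (ρ * condRenyi ρ p)) ∧
    eveAmb ρ p e ≤ eveAmbAlt ρ p e ∧
    eveAmb ρ p e ≤
      min (((min (Fintype.card M₁) (Fintype.card M₂) : ℕ) : ℝ) ^ ρ * bobListAmb ρ p e)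
        ((2 : ℝ) ^ (ρ * condRenyi ρ p)) := by
  have hAlt := le_min (eveAmbAlt_le_card_rpow_mul_bobListAmb (p := p) (e := e) hρ hp0 he0)
    (eveAmbAlt_le_two_rpow_mul_condRenyi hρ hp0 hp1 he0 he1)
  have hEve := eveAmb_le_eveAmbAlt hρ hp0 he0
  exact ⟨max_le (two_rpow_le_bobListAmb hρ hp0 hp1 he0 he1)
    (one_le_bobListAmb hρ hp0 hp1 he0 he1), hAlt, hEve, hEve.trans hAlt⟩
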